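/- arXiv:2402.11981 — 3 statements merged into one kernel-verified Lean document; each statement's English description precedes it below -/
import Mathlib

section
/- For every λ ≥ 0, f ∈ F and ξ ∈ Ξ: (i) φ^{τ,ε}(λ, f, ξ) ∈ [−‖F‖∞ − λ m_c, ‖F‖∞]; (ii) the map f ↦ φ^{τ,ε}(λ, f, ξ) is 1-Lipschitz on F with respect to the uniform norm. Moreover, given 0 < λ_low ≤ λ_up < ∞, for every μ ∈ [1/λ_up, 1/λ_low], f ∈ F and ξ ∈ Ξ: (iii) ψ^{τ,ε}(μ, f, ξ) ∈ [−‖F‖∞/λ_low − m_c, ‖F‖∞/λ_low]; (iv) the map (μ, f) ↦ ψ^{τ,ε}(μ, f, ξ) is Lipschitz on [1/λ_up, 1/λ_low] × F with constant ‖F‖∞ + 1/λ_low + (λ_up ε/(ε + λ_up τ)) m_c, with respect to the distance ((μ, f), (μ', f')) ↦ |μ − μ'| + ‖f − f'‖∞. -/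
open MeasureTheory Filter Set
open scoped ENNReal NNReal

noncomputable section

/-- The `t`-packing number of `F` for the uniform norm: the maximal cardinality of a
subset of `F` whose elements are pairwise at distance at least `t`. -/
def packingNum {Ξ : Type*} [TopologicalSpace Ξ] [CompactSpace Ξ]
    (F : Set C(Ξ, ℝ)) (t : ℝ) : ℝ≥0∞ :=
  ⨆ (s : Finset C(Ξ, ℝ)) (_ : ↑s ⊆ F ∧ (s : Set C(Ξ, ℝ)).Pairwise fun f g => t ≤ dist f g),
    (s.card : ℝ≥0∞)

/-- Dudley's entropy integral of `F`. -/
def dudleyEntropy {Ξ : Type*} [TopologicalSpace Ξ] [CompactSpace Ξ] (F : Set C(Ξ, ℝ)) : ℝ :=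
  ∫ t in Ioi (0 : ℝ), Real.sqrt (Real.log ((packingNum F t).toReal))

/-- `‖F‖∞ = sup_{f ∈ F} ‖f‖∞`. -/
def supNormF {Ξ : Type*} [TopologicalSpace Ξ] [CompactSpace Ξ] (F : Set C(Ξ, ℝ)) : ℝ :=
  ⨆ f : F, ‖(f : C(Ξ, ℝ))‖

/-- Optimal transport cost `W_c(Q, Q')`. -/
def transportCost {Ξ : Type*} [MeasurableSpace Ξ] (c : Ξ → Ξ → ℝ) (Q Q' : Measure Ξ) : ℝ :=
  sInf { r | ∃ π : Measure (Ξ × Ξ), IsProbabilityMeasure π ∧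
    π.map Prod.fst = Q ∧ π.map Prod.snd = Q' ∧ r = ∫ p, c p.1 p.2 ∂π }

/-- The Wasserstein robust risk `R_{ρ,Q}(f)`. -/
def robustRisk {Ξ : Type*} [MeasurableSpace Ξ] (c : Ξ → Ξ → ℝ) (ρ : ℝ)
    (Q : Measure Ξ) (f : Ξ → ℝ) : ℝ :=
  sSup { r | ∃ Q' : Measure Ξ, IsProbabilityMeasure Q' ∧ transportCost c Q Q' ≤ ρ ∧
    r = ∫ ξ, f ξ ∂Q' }

/-- Empirical measure `P̂_n` of a sample `ω`. -/
def empiricalMeasure {Ξ : Type*} [MeasurableSpace Ξ] (n : ℕ) (ω : Fin n → Ξ) : Measure Ξ :=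
  (n : ℝ≥0∞)⁻¹ • ∑ i : Fin n, Measure.dirac (ω i)

/-- Set of maximizers of `f` over `Ξ`. -/
def argmaxSet {Ξ : Type*} [TopologicalSpace Ξ] (f : C(Ξ, ℝ)) : Set Ξ := {ζ | ∀ ξ, f ξ ≤ f ζ}

/-- The critical radius `ρ_crit`. -/
def rhoCrit {Ξ : Type*} [TopologicalSpace Ξ] [MeasurableSpace Ξ]
    (c : Ξ → Ξ → ℝ) (P : Measure Ξ) (F : Set C(Ξ, ℝ)) : ℝ :=
  ⨅ f : F, ∫ ξ, sInf (c ξ '' argmaxSet (f : C(Ξ, ℝ))) ∂P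

/-- The maximal radius `ρ_max(λ)`. -/
def rhoMax {Ξ : Type*} [TopologicalSpace Ξ] [MeasurableSpace Ξ]
    (c : Ξ → Ξ → ℝ) (P : Measure Ξ) (F : Set C(Ξ, ℝ)) (lam : ℝ) : ℝ :=
  ⨅ f : F, ∫ ξ,
    sInf (c ξ '' {ζ | ∀ ζ', (f : C(Ξ, ℝ)) ζ' - lam * c ξ ζ' ≤ (f : C(Ξ, ℝ)) ζ - lam * c ξ ζ}) ∂P

/-- The dual generator `φ(λ, f, ξ) = sup_ζ (f(ζ) - λ c(ξ, ζ))`. -/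
def dualGen {Ξ : Type*} (c : Ξ → Ξ → ℝ) (lam : ℝ) (f : Ξ → ℝ) (ξ : Ξ) : ℝ :=
  ⨆ ζ, (f ζ - lam * c ξ ζ)

/-- `ψ(μ, f, ξ) = μ φ(μ⁻¹, f, ξ)`. -/
def psiGen {Ξ : Type*} (c : Ξ → Ξ → ℝ) (μ : ℝ) (f : Ξ → ℝ) (ξ : Ξ) : ℝ :=
  μ * dualGen c μ⁻¹ f ξ

/-- Real-valued Kullback–Leibler divergence `KL(μ‖ν) = ∫ log (dμ/dν) dμ`. -/
def KLdiv {α : Type*} [MeasurableSpace α] (μ ν : Measure α) : ℝ :=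
  ∫ x, Real.log ((μ.rnDeriv ν) x).toReal ∂μ

/-- `m_c = max_ξ E_{ζ∼π₀(·|ξ)}[c(ξ,ζ)]`. -/
def mC {Ξ : Type*} [MeasurableSpace Ξ] (c : Ξ → Ξ → ℝ) (π0cond : Ξ → Measure Ξ) : ℝ :=
  ⨆ ξ : Ξ, ∫ ζ, c ξ ζ ∂(π0cond ξ)

/-- `m_{2,c} = max_ξ E_{ζ∼π₀(·|ξ)}[c(ξ,ζ)²]`. -/
def m2C {Ξ : Type*} [MeasurableSpace Ξ] (c : Ξ → Ξ → ℝ) (π0cond : Ξ → Measure Ξ) : ℝ :=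
  ⨆ ξ : Ξ, ∫ ζ, (c ξ ζ) ^ 2 ∂(π0cond ξ)

/-- The regularized dual generator `φ^{τ,ε}(λ, f, ξ)`. -/
def phiReg {Ξ : Type*} [MeasurableSpace Ξ] (c : Ξ → Ξ → ℝ) (π0cond : Ξ → Measure Ξ)
    (τ ε lam : ℝ) (f : Ξ → ℝ) (ξ : Ξ) : ℝ :=
  (ε + lam * τ) * Real.log (∫ ζ, Real.exp ((f ζ - lam * c ξ ζ) / (ε + lam * τ)) ∂(π0cond ξ))

/-- `ψ^{τ,ε}(μ, f, ξ) = μ φ^{τ,ε}(μ⁻¹, f, ξ)`. -/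
def psiReg {Ξ : Type*} [MeasurableSpace Ξ] (c : Ξ → Ξ → ℝ) (π0cond : Ξ → Measure Ξ)
    (τ ε μ : ℝ) (f : Ξ → ℝ) (ξ : Ξ) : ℝ :=
  μ * phiReg c π0cond τ ε μ⁻¹ f ξ

/-- The regularized critical radius `ρ_crit^{τ,ε}`. -/
def rhoCritReg {Ξ : Type*} [TopologicalSpace Ξ] [MeasurableSpace Ξ]
    (c : Ξ → Ξ → ℝ) (π0cond : Ξ → Measure Ξ) (τ ε : ℝ) (P : Measure Ξ)
    (F : Set C(Ξ, ℝ)) : ℝ :=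
  ⨅ f : F, ∫ ξ,
    ((∫ ζ, (τ / ε * (f : C(Ξ, ℝ)) ζ + c ξ ζ)
        ∂((π0cond ξ).tilted fun ζ => (f : C(Ξ, ℝ)) ζ / ε))
      - τ * Real.log (∫ ζ, Real.exp ((f : C(Ξ, ℝ)) ζ / ε) ∂(π0cond ξ))) ∂P

/-- The regularized maximal radius `ρ_max^{τ,ε}(λ)`, defined through the derivative in `λ`
of the regularized dual generator. -/
def rhoMaxReg {Ξ : Type*} [TopologicalSpace Ξ] [MeasurableSpace Ξ]
    (c : Ξ → Ξ → ℝ) (π0cond : Ξ → Measure Ξ) (τ ε : ℝ) (P : Measure Ξ)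
    (F : Set C(Ξ, ℝ)) (lam : ℝ) : ℝ :=
  ⨅ f : F, ∫ ξ, -(deriv (fun l => phiReg c π0cond τ ε l (fun ζ => (f : C(Ξ, ℝ)) ζ) ξ) lam) ∂P

/-- The doubly regularized robust risk `R^{τ,ε}_{ρ,Q}(f)`. -/
def regRobustRisk {Ξ : Type*} [MeasurableSpace Ξ] (c : Ξ → Ξ → ℝ) (π0 : Measure (Ξ × Ξ))
    (τ ε ρ : ℝ) (Q : Measure Ξ) (f : Ξ → ℝ) : ℝ :=
  sSup { r | ∃ π : Measure (Ξ × Ξ), IsProbabilityMeasure π ∧ π.map Prod.fst = Q ∧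
    π ≪ π0 ∧ Integrable (fun p => Real.log ((π.rnDeriv π0) p).toReal) π ∧
    (∫ p, c p.1 p.2 ∂π) + τ * KLdiv π π0 ≤ ρ ∧
    r = (∫ p, f p.2 ∂π) - ε * KLdiv π π0 }

/-- The entropy-regularized optimal transport cost `W^τ_c(P, Q)`. -/
def regTransportCost {Ξ : Type*} [MeasurableSpace Ξ] (c : Ξ → Ξ → ℝ) (π0 : Measure (Ξ × Ξ))
    (τ : ℝ) (P Q : Measure Ξ) : ℝ :=
  sInf { r | ∃ π : Measure (Ξ × Ξ), IsProbabilityMeasure π ∧ π.map Prod.fst = P ∧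
    π.map Prod.snd = Q ∧ π ≪ π0 ∧
    Integrable (fun p => Real.log ((π.rnDeriv π0) p).toReal) π ∧
    r = (∫ p, c p.1 p.2 ∂π) + τ * KLdiv π π0 }

/-- A continuous function on a compact space is integrable for a finite measure. -/
lemma Continuous.integrable_of_compactSpace {X : Type*} [TopologicalSpace X] [CompactSpace X]
    [MeasurableSpace X] [BorelSpace X] {ν : Measure X} [IsFiniteMeasure ν] {h : X → ℝ}
    (hh : Continuous h) : Integrable h ν :=
  hh.integrable_of_hasCompactSupport (HasCompactSupport.of_compactSpace h)

section LogIntegralExp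

variable {X : Type*} [TopologicalSpace X] [CompactSpace X] [MeasurableSpace X] [BorelSpace X]
  {ν : Measure X} [IsProbabilityMeasure ν]

lemma integral_exp_pos_of_continuous {h : X → ℝ} (hh : Continuous h) :
    0 < ∫ x, Real.exp (h x) ∂ν :=
  integral_exp_pos (Real.continuous_exp.comp hh).integrable_of_compactSpace

lemma log_integral_exp_le_add {h k : X → ℝ} {d : ℝ} (hh : Continuous h) (hk : Continuous k)
    (hle : ∀ x, h x ≤ k x + d) :
    Real.log (∫ x, Real.exp (h x) ∂ν) ≤ Real.log (∫ x, Real.exp (k x) ∂ν) + d := by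
  have hpos := integral_exp_pos_of_continuous (ν := ν) hk
  rw [← Real.log_exp d, ← Real.log_mul hpos.ne' (Real.exp_pos d).ne',
    ← integral_mul_const]
  refine Real.log_le_log (integral_exp_pos_of_continuous hh) (integral_mono ?_ ?_ fun x => ?_)
  · exact (Real.continuous_exp.comp hh).integrable_of_compactSpace
  · exact ((Real.continuous_exp.comp hk).mul continuous_const).integrable_of_compactSpace
  · simp only [← Real.exp_add]
    exact Real.exp_le_exp.2 (hle x)

lemma integral_le_log_integral_exp {h : X → ℝ} (hh : Continuous h) :
    ∫ x, h x ∂ν ≤ Real.log (∫ x, Real.exp (h x) ∂ν) := by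
  rw [Real.le_log_iff_exp_le (integral_exp_pos_of_continuous hh)]
  exact convexOn_exp.map_integral_le Real.continuous_exp.continuousOn isClosed_univ
    (Eventually.of_forall fun _ => Set.mem_univ _) hh.integrable_of_compactSpace
    (Real.continuous_exp.comp hh).integrable_of_compactSpace

/-- The map `s ↦ s log E[exp (h / s)]` is nonincreasing. -/
lemma mul_log_integral_exp_div_anti {h : X → ℝ} (hh : Continuous h) {s t : ℝ} (hs : 0 < s)
    (hst : s ≤ t) :
    t * Real.log (∫ x, Real.exp (h x / t) ∂ν) ≤ s * Real.log (∫ x, Real.exp (h x / s) ∂ν) := by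
  have ht : 0 < t := hs.trans_le hst
  have hpos := integral_exp_pos_of_continuous (ν := ν) (hh.div_const t)
  have hpow : ∀ x, Real.exp (h x / t) ^ (t / s) = Real.exp (h x / s) := fun x => by
    rw [← Real.exp_mul]
    congr 1
    field_simp
  have jensen : (∫ x, Real.exp (h x / t) ∂ν) ^ (t / s) ≤ ∫ x, Real.exp (h x / s) ∂ν := by
    simp_rw [← hpow]
    refine (convexOn_rpow ((one_le_div hs).2 hst)).map_integral_le
      (Real.continuous_rpow_const (by positivity)).continuousOn isClosed_Ici
      (Eventually.of_forall fun x => (Real.exp_pos _).le)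
      (Real.continuous_exp.comp (hh.div_const t)).integrable_of_compactSpace ?_
    exact ((Real.continuous_rpow_const (by positivity)).comp
      (Real.continuous_exp.comp (hh.div_const t))).integrable_of_compactSpace
  have hlog := Real.log_le_log (Real.rpow_pos_of_pos hpos _) jensen
  rw [Real.log_rpow hpos, div_mul_eq_mul_div, div_le_iff₀ hs] at hlog
  linarith

end LogIntegralExp

lemma psiReg_eq {Ξ : Type*} [MeasurableSpace Ξ] {c : Ξ → Ξ → ℝ} {π0cond : Ξ → Measure Ξ}
    {τ ε : ℝ} {ξ : Ξ} {μ : ℝ} (hμ : 0 < μ) (f : Ξ → ℝ) :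
    psiReg c π0cond τ ε μ f ξ = (μ * ε + τ) *
      Real.log (∫ ζ, Real.exp ((μ * f ζ - c ξ ζ) / (μ * ε + τ)) ∂(π0cond ξ)) := by
  have hs : μ * (ε + μ⁻¹ * τ) = μ * ε + τ := by field_simp
  have hh : ∀ ζ, (f ζ - μ⁻¹ * c ξ ζ) / (ε + μ⁻¹ * τ) = (μ * f ζ - c ξ ζ) / (μ * ε + τ) :=
    fun ζ => by
      rw [← hs, ← mul_div_mul_left _ _ hμ.ne', mul_sub, mul_inv_cancel_left₀ hμ.ne']
  simp only [psiReg, phiReg, hh]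
  rw [← mul_assoc, hs]

section Generator

variable {Ξ : Type*} [TopologicalSpace Ξ] [CompactSpace Ξ]

lemma norm_le_supNormF {F : Set C(Ξ, ℝ)} (hF : IsCompact F) {f : C(Ξ, ℝ)} (hf : f ∈ F) :
    ‖f‖ ≤ supNormF F := by
  have hb : BddAbove (Set.range fun f : F => ‖(f : C(Ξ, ℝ))‖) := by
    obtain ⟨R, hR⟩ := hF.isBounded.exists_norm_le
    exact ⟨R, by rintro _ ⟨f, rfl⟩; exact hR f f.2⟩
  exact le_ciSup hb ⟨f, hf⟩

variable [MeasurableSpace Ξ] [BorelSpace Ξ] {c : Ξ → Ξ → ℝ} {π0cond : Ξ → Measure Ξ}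

lemma integral_cost_le_mC (hc : Continuous fun p : Ξ × Ξ => c p.1 p.2)
    (hcond : ∀ ξ, IsProbabilityMeasure (π0cond ξ)) (ξ : Ξ) :
    ∫ ζ, c ξ ζ ∂(π0cond ξ) ≤ mC c π0cond := by
  obtain ⟨R, hR⟩ := (isCompact_range hc).bddAbove
  refine le_ciSup (f := fun ξ => ∫ ζ, c ξ ζ ∂(π0cond ξ)) ⟨R, ?_⟩ ξ
  rintro _ ⟨η, rfl⟩
  have hη : Continuous fun ζ => c η ζ := hc.comp (Continuous.prodMk_right η)
  calc ∫ ζ, c η ζ ∂(π0cond η) ≤ ∫ _, R ∂(π0cond η) :=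
        integral_mono hη.integrable_of_compactSpace (integrable_const R)
          fun ζ => hR ⟨(η, ζ), rfl⟩
    _ = R := by simp

variable {τ ε : ℝ} {ξ : Ξ} [IsProbabilityMeasure (π0cond ξ)]

lemma phiReg_le_norm (hc : Continuous (c ξ)) (hc_nonneg : ∀ ζ, 0 ≤ c ξ ζ)
    (hτ : 0 ≤ τ) (hε : 0 < ε) {lam : ℝ} (hlam : 0 ≤ lam) (f : C(Ξ, ℝ)) :
    phiReg c π0cond τ ε lam f ξ ≤ ‖f‖ := by
  have hs : 0 < ε + lam * τ := by positivity
  have hle := log_integral_exp_le_add (ν := π0cond ξ) (d := ‖f‖ / (ε + lam * τ))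
    (h := fun ζ => (f ζ - lam * c ξ ζ) / (ε + lam * τ)) (k := fun _ => 0)
    (by fun_prop) continuous_const fun ζ => by
      rw [zero_add]
      gcongr
      linarith [(le_abs_self _).trans (f.norm_coe_le_norm ζ), mul_nonneg hlam (hc_nonneg ζ)]
  simp only [Real.exp_zero, integral_const, probReal_univ, smul_eq_mul, mul_one, Real.log_one,
    zero_add] at hle
  rw [le_div_iff₀ hs] at hle
  unfold phiReg
  linarith

lemma neg_norm_sub_le_phiReg (hc : Continuous (c ξ)) (hτ : 0 ≤ τ) (hε : 0 < ε) {lam : ℝ}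
    (hlam : 0 ≤ lam) (f : C(Ξ, ℝ)) :
    -‖f‖ - lam * ∫ ζ, c ξ ζ ∂(π0cond ξ) ≤ phiReg c π0cond τ ε lam f ξ := by
  have hs : 0 < ε + lam * τ := by positivity
  have hle := integral_le_log_integral_exp (ν := π0cond ξ)
    (h := fun ζ => (f ζ - lam * c ξ ζ) / (ε + lam * τ)) (by fun_prop)
  rw [integral_div, integral_sub f.continuous.integrable_of_compactSpace
    (hc.integrable_of_compactSpace.const_mul lam), integral_const_mul, div_le_iff₀ hs] at hle
  have hf : -‖f‖ ≤ ∫ ζ, f ζ ∂(π0cond ξ) := by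
    have := integral_mono (μ := π0cond ξ) (integrable_const (-‖f‖))
      f.continuous.integrable_of_compactSpace
      fun ζ => (abs_le.1 (f.norm_coe_le_norm ζ)).1
    simpa using this
  unfold phiReg
  linarith

lemma phiReg_sub_le_dist (hc : Continuous (c ξ)) (hτ : 0 ≤ τ) (hε : 0 < ε) {lam : ℝ}
    (hlam : 0 ≤ lam) (f g : C(Ξ, ℝ)) :
    phiReg c π0cond τ ε lam f ξ - phiReg c π0cond τ ε lam g ξ ≤ dist f g := by
  have hs : 0 < ε + lam * τ := by positivity
  have hle := log_integral_exp_le_add (ν := π0cond ξ) (d := dist f g / (ε + lam * τ))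
    (h := fun ζ => (f ζ - lam * c ξ ζ) / (ε + lam * τ))
    (k := fun ζ => (g ζ - lam * c ξ ζ) / (ε + lam * τ))
    (by fun_prop) (by fun_prop) fun ζ => by
      rw [← add_div]
      gcongr
      have := (le_abs_self _).trans (ContinuousMap.dist_apply_le_dist (f := f) (g := g) ζ)
      linarith
  have := mul_le_mul_of_nonneg_left hle hs.le
  rw [mul_add, mul_div_cancel₀ _ hs.ne'] at this
  unfold phiReg
  linarith

lemma abs_phiReg_sub_le_dist (hc : Continuous (c ξ)) (hτ : 0 ≤ τ) (hε : 0 < ε) {lam : ℝ}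
    (hlam : 0 ≤ lam) (f g : C(Ξ, ℝ)) :
    |phiReg c π0cond τ ε lam f ξ - phiReg c π0cond τ ε lam g ξ| ≤ dist f g :=
  abs_sub_le_iff.2 ⟨phiReg_sub_le_dist hc hτ hε hlam f g,
    dist_comm f g ▸ phiReg_sub_le_dist hc hτ hε hlam g f⟩

lemma psiReg_sub_le (hc : Continuous (c ξ)) (hτ : 0 ≤ τ) (hε : 0 < ε) {μ μ' : ℝ} (hμ : 0 < μ)
    (hμμ' : μ ≤ μ') (f : C(Ξ, ℝ)) :
    psiReg c π0cond τ ε μ' f ξ - psiReg c π0cond τ ε μ f ξ ≤ ‖f‖ * (μ' - μ) := by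
  have hs : 0 < μ * ε + τ := by positivity
  have hst : μ * ε + τ ≤ μ' * ε + τ := by gcongr
  have ht := hs.trans_le hst
  have hanti := mul_log_integral_exp_div_anti (ν := π0cond ξ) (h := fun ζ => μ * f ζ - c ξ ζ)
    (by fun_prop) hs hst
  have hle := log_integral_exp_le_add (ν := π0cond ξ) (d := ‖f‖ * (μ' - μ) / (μ' * ε + τ))
    (h := fun ζ => (μ' * f ζ - c ξ ζ) / (μ' * ε + τ))
    (k := fun ζ => (μ * f ζ - c ξ ζ) / (μ' * ε + τ))
    (by fun_prop) (by fun_prop) fun ζ => by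
      rw [← add_div]
      gcongr
      have := mul_le_mul_of_nonneg_right ((le_abs_self _).trans (f.norm_coe_le_norm ζ))
        (sub_nonneg.2 hμμ')
      linarith
  have := mul_le_mul_of_nonneg_left hle ht.le
  rw [mul_add, mul_div_cancel₀ _ ht.ne'] at this
  rw [psiReg_eq hμ, psiReg_eq (hμ.trans_le hμμ')]
  linarith

lemma neg_norm_sub_le_psiReg (hc : Continuous (c ξ)) (hτ : 0 ≤ τ) (hε : 0 < ε) {μ : ℝ}
    (hμ : 0 < μ) (f : C(Ξ, ℝ)) :
    -(μ * ‖f‖) - ∫ ζ, c ξ ζ ∂(π0cond ξ) ≤ psiReg c π0cond τ ε μ f ξ := by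
  have := mul_le_mul_of_nonneg_left
    (neg_norm_sub_le_phiReg (π0cond := π0cond) hc hτ hε (inv_nonneg.2 hμ.le) f) hμ.le
  rw [mul_sub, mul_inv_cancel_left₀ hμ.ne', mul_neg] at this
  exact this

lemma psiReg_sub_le' (hc : Continuous (c ξ)) (hc_nonneg : ∀ ζ, 0 ≤ c ξ ζ) (hτ : 0 ≤ τ)
    (hε : 0 < ε) {μ μ' : ℝ} (hμ : 0 < μ) (hμμ' : μ ≤ μ') (f : C(Ξ, ℝ)) :
    psiReg c π0cond τ ε μ f ξ - psiReg c π0cond τ ε μ' f ξ ≤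
      (‖f‖ + ε / (μ' * ε + τ) * ∫ ζ, c ξ ζ ∂(π0cond ξ)) * (μ' - μ) := by
  have hμ' := hμ.trans_le hμμ'
  have hs : 0 < μ * ε + τ := by positivity
  have ht : 0 < μ' * ε + τ := by positivity
  have hst : μ * ε + τ ≤ μ' * ε + τ := by gcongr
  have hratio : μ / (μ * ε + τ) ≤ μ' / (μ' * ε + τ) := by
    rw [div_le_div_iff₀ hs ht]
    nlinarith
  have hle := log_integral_exp_le_add (ν := π0cond ξ)
    (d := ‖f‖ * (μ' / (μ' * ε + τ) - μ / (μ * ε + τ)))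
    (h := fun ζ => (μ * f ζ - c ξ ζ) / (μ * ε + τ))
    (k := fun ζ => (μ' * f ζ - c ξ ζ) / (μ' * ε + τ))
    (by fun_prop) (by fun_prop) fun ζ => by
      have hf := mul_le_mul_of_nonneg_right (abs_le.1 (f.norm_coe_le_norm ζ)).1
        (sub_nonneg.2 hratio)
      have hcost : c ξ ζ / (μ' * ε + τ) ≤ c ξ ζ / (μ * ε + τ) :=
        div_le_div_of_nonneg_left (hc_nonneg ζ) hs hst
      rw [sub_div, sub_div, mul_div_right_comm, mul_div_right_comm]
      linarith
  have hlow := neg_norm_sub_le_psiReg (π0cond := π0cond) hc hτ hε hμ' f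
  rw [psiReg_eq hμ'] at hlow
  rw [psiReg_eq hμ, psiReg_eq hμ']
  set A := Real.log (∫ ζ, Real.exp ((μ * f ζ - c ξ ζ) / (μ * ε + τ)) ∂(π0cond ξ))
  set B := Real.log (∫ ζ, Real.exp ((μ' * f ζ - c ξ ζ) / (μ' * ε + τ)) ∂(π0cond ξ))
  set m := ∫ ζ, c ξ ζ ∂(π0cond ξ)
  have hB : -((μ' * ‖f‖ + m) / (μ' * ε + τ)) ≤ B := by
    rw [← neg_div, div_le_iff₀ ht]
    linarith
  calc (μ * ε + τ) * A - (μ' * ε + τ) * B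
      ≤ (μ * ε + τ) * (B + ‖f‖ * (μ' / (μ' * ε + τ) - μ / (μ * ε + τ))) - (μ' * ε + τ) * B := by
        gcongr
    _ = (μ * ε + τ) * (‖f‖ * (μ' / (μ' * ε + τ) - μ / (μ * ε + τ))) + ε * (μ' - μ) * -B := by
        ring
    _ ≤ (μ * ε + τ) * (‖f‖ * (μ' / (μ' * ε + τ) - μ / (μ * ε + τ))) +
          ε * (μ' - μ) * ((μ' * ‖f‖ + m) / (μ' * ε + τ)) := by
        have : 0 ≤ ε * (μ' - μ) := mul_nonneg hε.le (sub_nonneg.2 hμμ')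
        gcongr
        linarith
    _ = (‖f‖ + ε / (μ' * ε + τ) * m) * (μ' - μ) := by
        field_simp
        ring

lemma abs_psiReg_sub_le (hc : Continuous (c ξ)) (hc_nonneg : ∀ ζ, 0 ≤ c ξ ζ) (hτ : 0 ≤ τ)
    (hε : 0 < ε) {b μ μ' : ℝ} (hb : 0 < b) (hμ : b ≤ μ) (hμ' : b ≤ μ') (f : C(Ξ, ℝ)) :
    |psiReg c π0cond τ ε μ f ξ - psiReg c π0cond τ ε μ' f ξ| ≤
      (‖f‖ + ε / (b * ε + τ) * ∫ ζ, c ξ ζ ∂(π0cond ξ)) * |μ - μ'| := by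
  wlog hle : μ ≤ μ' generalizing μ μ'
  · rw [abs_sub_comm, abs_sub_comm μ]
    exact this hμ' hμ (le_of_not_ge hle)
  have hm : 0 ≤ ∫ ζ, c ξ ζ ∂(π0cond ξ) := integral_nonneg hc_nonneg
  have hμ0 := hb.trans_le hμ
  rw [abs_sub_comm μ, abs_of_nonneg (sub_nonneg.2 hle), abs_sub_le_iff]
  have hd : 0 ≤ μ' - μ := sub_nonneg.2 hle
  constructor
  · refine (psiReg_sub_le' hc hc_nonneg hτ hε hμ0 hle f).trans ?_
    gcongr
  · refine (psiReg_sub_le hc hτ hε hμ0 hle f).trans ?_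
    gcongr
    have : 0 ≤ ε / (b * ε + τ) := by positivity
    nlinarith

end Generator

/-- **Concentration conditions for regularized WDRO** (Lemma C.3): bounds and Lipschitz
constants for `φ^{τ,ε}` and `ψ^{τ,ε}`. -/
theorem reg_dual_generator_bounds_and_lipschitz
    {Ξ : Type*} [MetricSpace Ξ] [CompactSpace Ξ] [Nonempty Ξ]
    [MeasurableSpace Ξ] [BorelSpace Ξ]
    (c : Ξ → Ξ → ℝ)
    (hc_cont : Continuous fun p : Ξ × Ξ => c p.1 p.2)
    (hc_nonneg : ∀ ξ ζ, 0 ≤ c ξ ζ)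
    (hc_zero : ∀ ξ ζ, c ξ ζ = 0 ↔ ξ = ζ)
    (F : Set C(Ξ, ℝ)) (hFcomp : IsCompact F)
    (τ ε : ℝ) (hτ : 0 ≤ τ) (hε : 0 < ε)
    (π0cond : Ξ → Measure Ξ) (hcond : ∀ ξ, IsProbabilityMeasure (π0cond ξ)) :
    (∀ lam : ℝ, 0 ≤ lam → ∀ f ∈ F, ∀ ξ : Ξ,
      -supNormF F - lam * mC c π0cond ≤ phiReg c π0cond τ ε lam (⇑f) ξ ∧
      phiReg c π0cond τ ε lam (⇑f) ξ ≤ supNormF F) ∧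
    (∀ lam : ℝ, 0 ≤ lam → ∀ ξ : Ξ, ∀ f ∈ F, ∀ g ∈ F,
      |phiReg c π0cond τ ε lam (⇑f) ξ - phiReg c π0cond τ ε lam (⇑g) ξ| ≤ dist f g) ∧
    (∀ lamLow lamUp : ℝ, 0 < lamLow → lamLow ≤ lamUp →
      ∀ μ ∈ Icc lamUp⁻¹ lamLow⁻¹, ∀ f ∈ F, ∀ ξ : Ξ,
        -(supNormF F / lamLow) - mC c π0cond ≤ psiReg c π0cond τ ε μ (⇑f) ξ ∧
        psiReg c π0cond τ ε μ (⇑f) ξ ≤ supNormF F / lamLow) ∧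
    (∀ lamLow lamUp : ℝ, 0 < lamLow → lamLow ≤ lamUp → ∀ ξ : Ξ,
      ∀ μ ∈ Icc lamUp⁻¹ lamLow⁻¹, ∀ μ' ∈ Icc lamUp⁻¹ lamLow⁻¹, ∀ f ∈ F, ∀ g ∈ F,
        |psiReg c π0cond τ ε μ (⇑f) ξ - psiReg c π0cond τ ε μ' (⇑g) ξ| ≤
          (supNormF F + lamLow⁻¹ + lamUp * ε / (ε + lamUp * τ) * mC c π0cond) *
            (|μ - μ'| + dist f g)) := by
  have hcξ : ∀ ξ, Continuous (c ξ) := fun ξ => hc_cont.comp (Continuous.prodMk_right ξ)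
  have hm := fun ξ => integral_cost_le_mC hc_cont hcond ξ
  have hphi : ∀ lam : ℝ, 0 ≤ lam → ∀ f ∈ F, ∀ ξ : Ξ,
      -supNormF F - lam * mC c π0cond ≤ phiReg c π0cond τ ε lam (⇑f) ξ ∧
      phiReg c π0cond τ ε lam (⇑f) ξ ≤ supNormF F := by
    intro lam hlam f hf ξ
    have hfF := norm_le_supNormF hFcomp hf
    refine ⟨le_trans ?_ (neg_norm_sub_le_phiReg (hcξ ξ) hτ hε hlam f),
      (phiReg_le_norm (hcξ ξ) (hc_nonneg ξ) hτ hε hlam f).trans hfF⟩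
    gcongr
    exact hm ξ
  refine ⟨hphi, fun lam hlam ξ f _ g _ => abs_phiReg_sub_le_dist (hcξ ξ) hτ hε hlam f g, ?_, ?_⟩
  · intro lamLow lamUp hlow hlowUp μ hμ f hf ξ
    have hμ0 : 0 < μ := (inv_pos.2 (hlow.trans_le hlowUp)).trans_le hμ.1
    have hF0 : 0 ≤ supNormF F := (norm_nonneg f).trans (norm_le_supNormF hFcomp hf)
    have hμF : μ * supNormF F ≤ supNormF F / lamLow := by
      rw [div_eq_inv_mul]
      exact mul_le_mul_of_nonneg_right hμ.2 hF0
    obtain ⟨hl, hu⟩ := hphi μ⁻¹ (inv_nonneg.2 hμ0.le) f hf ξ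
    have hl := mul_le_mul_of_nonneg_left hl hμ0.le
    have hu := mul_le_mul_of_nonneg_left hu hμ0.le
    rw [mul_sub, mul_inv_cancel_left₀ hμ0.ne', mul_neg] at hl
    unfold psiReg
    constructor <;> linarith
  · intro lamLow lamUp hlow hlowUp ξ μ hμ μ' hμ' f hf g hg
    have hUp : 0 < lamUp := hlow.trans_le hlowUp
    have hb : 0 < lamUp⁻¹ := inv_pos.2 hUp
    have hμ'0 : 0 < μ' := hb.trans_le hμ'.1
    have hfF := norm_le_supNormF hFcomp hf
    have hF0 : 0 ≤ supNormF F := (norm_nonneg f).trans hfF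
    have hm0 : 0 ≤ mC c π0cond := (integral_nonneg (hc_nonneg ξ)).trans (hm ξ)
    have hK : ε / (lamUp⁻¹ * ε + τ) = lamUp * ε / (ε + lamUp * τ) := by
      field_simp
    have hK0 : 0 ≤ lamUp * ε / (ε + lamUp * τ) := by positivity
    have hfst : |psiReg c π0cond τ ε μ f ξ - psiReg c π0cond τ ε μ' f ξ| ≤
        (supNormF F + lamUp * ε / (ε + lamUp * τ) * mC c π0cond) * |μ - μ'| := by
      refine (abs_psiReg_sub_le (hcξ ξ) (hc_nonneg ξ) hτ hε hb hμ.1 hμ'.1 f).trans ?_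
      rw [hK]
      gcongr
      exact hm ξ
    have hsnd : |psiReg c π0cond τ ε μ' f ξ - psiReg c π0cond τ ε μ' g ξ| ≤
        lamLow⁻¹ * dist f g := by
      unfold psiReg
      rw [← mul_sub, abs_mul, abs_of_pos hμ'0]
      exact mul_le_mul hμ'.2 (abs_phiReg_sub_le_dist (hcξ ξ) hτ hε (inv_nonneg.2 hμ'0.le) f g)
        (abs_nonneg _) (inv_nonneg.2 hlow.le)
    have hA : 0 ≤ (supNormF F + lamUp * ε / (ε + lamUp * τ) * mC c π0cond) * dist f g := by
      positivity
    have hB : 0 ≤ lamLow⁻¹ * |μ - μ'| := by positivity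
    have htri := abs_sub_le (psiReg c π0cond τ ε μ f ξ) (psiReg c π0cond τ ε μ' f ξ)
      (psiReg c π0cond τ ε μ' g ξ)
    linarith
end
end

section
/- If ρ ≥ ρ_crit, then there exists f ∈ F such that R_ρ(f) = max_{ξ ∈ Ξ} f(ξ), i.e. the robust risk of f around P with radius ρ equals the worst-case value of f over Ξ. -/
open MeasureTheory Filter Set
open scoped ENNReal NNReal

noncomputable section

/-- Integration is jointly continuous in the integrand and the measure on a compact space. -/
lemma continuous_integral_continuousMap_probabilityMeasure
    {X : Type*} [TopologicalSpace X] [CompactSpace X] [MeasurableSpace X] [OpensMeasurableSpace X] :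
    Continuous fun p : C(X, ℝ) × ProbabilityMeasure X => ∫ x, p.1 x ∂(p.2 : Measure X) := by
  refine continuous_prod_of_continuous_lipschitzWith _ 1 (fun f => ?_) (fun μ => ?_)
  · exact ProbabilityMeasure.continuous_integral_continuousMap f
  · refine LipschitzWith.of_dist_le_mul fun f g => ?_
    have hint : ∀ h : C(X, ℝ), Integrable h (μ : Measure X) := fun h =>
      (BoundedContinuousFunction.mkOfCompact h).integrable _
    simp only [NNReal.coe_one, one_mul]
    rw [dist_eq_norm, ← integral_sub (hint f) (hint g)]
    refine (norm_integral_le_of_norm_le_const (C := dist f g) (.of_forall fun x => ?_)).trans ?_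
    · rw [← dist_eq_norm]
      exact ContinuousMap.dist_apply_le_dist x
    · simp

/-- A continuous cost can be minimised over a compact set, up to `ε`, by a measurable map. -/
lemma exists_measurable_forall_lt_sInf_add
    {X Y : Type*} [TopologicalSpace X] [MeasurableSpace X] [OpensMeasurableSpace X]
    [MetricSpace Y] [MeasurableSpace Y] [BorelSpace Y]
    {c : X → Y → ℝ} (hc : Continuous fun p : X × Y => c p.1 p.2)
    {A : Set Y} (hA : IsCompact A) (hAne : A.Nonempty) {ε : ℝ} (hε : 0 < ε) :
    ∃ T : X → Y, Measurable T ∧ (∀ x, T x ∈ A) ∧ ∀ x, c x (T x) < sInf (c x '' A) + ε := by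
  classical
  have : CompactSpace A := isCompact_iff_compactSpace.1 hA
  have : Nonempty A := hAne.to_subtype
  have hg : Continuous fun x => sInf (c x '' A) := hA.continuous_sInf hc
  let z := TopologicalSpace.denseSeq A
  have hex : ∀ x, ∃ k, c x (z k) < sInf (c x '' A) + ε := by
    intro x
    obtain ⟨_, ⟨a, ha, rfl⟩, hlt⟩ :=
      exists_lt_of_csInf_lt (hAne.image (c x)) (lt_add_of_pos_right (sInf (c x '' A)) hε)
    have hopen : IsOpen {a : A | c x a < sInf (c x '' A) + ε} :=
      isOpen_lt (hc.comp (by fun_prop : Continuous fun a : A => (x, (a : Y)))) continuous_const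
    exact (TopologicalSpace.denseRange_denseSeq A).exists_mem_open hopen ⟨⟨a, ha⟩, hlt⟩
  refine ⟨fun x => z (Nat.find (hex x)), ?_, fun x => (z _).2, fun x => Nat.find_spec (hex x)⟩
  have hfind : Measurable fun x => Nat.find (hex x) :=
    measurable_find hex fun k => (isOpen_lt
      (hc.comp (by fun_prop : Continuous fun x : X => (x, (z k : Y))))
      (hg.add continuous_const)).measurableSet
  exact (measurable_from_nat (f := fun k => (z k : Y))).comp hfind

lemma isCompact_argmaxSet {X : Type*} [TopologicalSpace X] [CompactSpace X] (f : C(X, ℝ)) :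
    IsCompact (argmaxSet f) := by
  have : IsClosed (argmaxSet f) := by
    simp only [argmaxSet, ofPred_forall]
    exact isClosed_iInter fun x => isClosed_le continuous_const f.continuous
  exact this.isCompact

lemma argmaxSet_nonempty {X : Type*} [TopologicalSpace X] [CompactSpace X] [Nonempty X]
    (f : C(X, ℝ)) : (argmaxSet f).Nonempty := by
  obtain ⟨x, -, hx⟩ := isCompact_univ.exists_isMaxOn univ_nonempty f.continuous.continuousOn
  exact ⟨x, fun y => hx (mem_univ y)⟩

/-- The pairs of an element of `F` and a coupling of `P` with a measure concentrated on its
maximizers. -/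
def maximizingCouplings {X : Type*} [TopologicalSpace X] [MeasurableSpace X]
    (P : Measure X) (F : Set C(X, ℝ)) : Set (C(X, ℝ) × ProbabilityMeasure (X × X)) :=
  {p | p.1 ∈ F ∧ (p.2 : Measure (X × X)).map Prod.fst = P ∧
    ∀ x, p.1 x ≤ ∫ q, p.1 q.2 ∂(p.2 : Measure (X × X))}

lemma isCompact_maximizingCouplings {X : Type*} [MetricSpace X] [CompactSpace X]
    [MeasurableSpace X] [BorelSpace X] (P : Measure X) [IsProbabilityMeasure P]
    {F : Set C(X, ℝ)} (hF : IsCompact F) : IsCompact (maximizingCouplings P F) := by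
  have hint : Continuous fun p : C(X, ℝ) × ProbabilityMeasure (X × X) =>
      ∫ q, p.1 q.2 ∂(p.2 : Measure (X × X)) :=
    continuous_integral_continuousMap_probabilityMeasure.comp
      (((ContinuousMap.continuous_precomp (⟨Prod.snd, continuous_snd⟩ : C(X × X, X))).comp
        continuous_fst).prodMk continuous_snd)
  have hmarg : IsClosed {p : C(X, ℝ) × ProbabilityMeasure (X × X) |
      (p.2 : Measure (X × X)).map Prod.fst = P} := by
    convert! isClosed_eq ((ProbabilityMeasure.continuous_map
      (continuous_fst : Continuous (Prod.fst : X × X → X))).comp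
        (continuous_snd : Continuous (Prod.snd : C(X, ℝ) × ProbabilityMeasure (X × X) → _)))
      (continuous_const (y := (⟨P, inferInstance⟩ : ProbabilityMeasure X))) using 3
    exact ⟨fun h => Subtype.ext h, fun h => congrArg Subtype.val h⟩
  have hmax : IsClosed {p : C(X, ℝ) × ProbabilityMeasure (X × X) |
      ∀ x, p.1 x ≤ ∫ q, p.1 q.2 ∂(p.2 : Measure (X × X))} := by
    simp only [ofPred_forall]
    exact isClosed_iInter fun x =>
      isClosed_le ((continuous_eval_const x).comp continuous_fst) hint
  convert (hF.prod isCompact_univ).inter_right (hmarg.inter hmax) using 1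
  ext p
  simp [maximizingCouplings]

lemma exists_mem_maximizingCouplings_integral_le {X : Type*} [MetricSpace X] [CompactSpace X]
    [Nonempty X] [MeasurableSpace X] [BorelSpace X]
    {c : X → X → ℝ} (hc : Continuous fun p : X × X => c p.1 p.2)
    (P : Measure X) [IsProbabilityMeasure P] {F : Set C(X, ℝ)} {f : C(X, ℝ)} (hf : f ∈ F)
    {ε : ℝ} (hε : 0 < ε) :
    ∃ π : ProbabilityMeasure (X × X), (f, π) ∈ maximizingCouplings P F ∧
      ∫ q, c q.1 q.2 ∂(π : Measure (X × X)) ≤ ∫ x, sInf (c x '' argmaxSet f) ∂P + ε := by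
  obtain ⟨T, hT, hTmem, hTlt⟩ :=
    exists_measurable_forall_lt_sInf_add hc (isCompact_argmaxSet f) (argmaxSet_nonempty f) hε
  have hpair : Measurable fun x => (x, T x) := measurable_id.prodMk hT
  have hprob : IsProbabilityMeasure (P.map fun x => (x, T x)) :=
    Measure.isProbabilityMeasure_map hpair.aemeasurable
  refine ⟨⟨P.map fun x => (x, T x), hprob⟩, ⟨hf, ?_, fun x => ?_⟩, ?_⟩
  · change (P.map fun x => (x, T x)).map Prod.fst = P
    rw [Measure.map_map measurable_fst hpair]
    exact Measure.map_id
  · change f x ≤ ∫ q, f q.2 ∂(P.map fun x => (x, T x))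
    rw [integral_map hpair.aemeasurable
      (by fun_prop : Continuous fun q : X × X => f q.2).aestronglyMeasurable]
    have hconst : ∀ y, f (T y) = f (T x) := fun y =>
      le_antisymm (hTmem x (T y)) (hTmem y (T x))
    simp only [hconst, integral_const, probReal_univ, one_smul]
    exact hTmem x x
  · change ∫ q, c q.1 q.2 ∂(P.map fun x => (x, T x)) ≤ _
    rw [integral_map hpair.aemeasurable hc.aestronglyMeasurable]
    have hg : Integrable (fun x => sInf (c x '' argmaxSet f)) P :=
      (BoundedContinuousFunction.mkOfCompact
        ⟨_, (isCompact_argmaxSet f).continuous_sInf hc⟩).integrable P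
    have hcint : Integrable (fun q : X × X => c q.1 q.2) (P.map fun x => (x, T x)) :=
      (BoundedContinuousFunction.mkOfCompact ⟨_, hc⟩).integrable _
    calc ∫ x, c x (T x) ∂P ≤ ∫ x, (sInf (c x '' argmaxSet f) + ε) ∂P :=
          integral_mono (hcint.comp_measurable hpair) (hg.add (integrable_const ε))
            fun x => (hTlt x).le
      _ = _ := by rw [integral_add hg (integrable_const ε)]; simp

/-- **The critical radius as a degeneracy threshold** (Proposition F.1, first part):
if `ρ ≥ ρ_crit` then some `f ∈ F` has robust risk equal to its worst-case value. -/
theorem robust_risk_degenerate_of_rhoCrit_le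
    {Ξ : Type*} [MetricSpace Ξ] [CompactSpace Ξ] [Nonempty Ξ]
    [MeasurableSpace Ξ] [BorelSpace Ξ]
    (c : Ξ → Ξ → ℝ)
    (hc_cont : Continuous fun p : Ξ × Ξ => c p.1 p.2)
    (hc_nonneg : ∀ ξ ζ, 0 ≤ c ξ ζ)
    (hc_zero : ∀ ξ ζ, c ξ ζ = 0 ↔ ξ = ζ)
    (F : Set C(Ξ, ℝ)) (hFcomp : IsCompact F) (hFne : F.Nonempty)
    (P : Measure Ξ) [IsProbabilityMeasure P]
    (ρ : ℝ) (hρ : rhoCrit c P F ≤ ρ) :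
    ∃ f ∈ F, robustRisk c ρ P ⇑f = ⨆ ξ : Ξ, f ξ := by
  obtain ⟨f₀, hf₀⟩ := hFne
  obtain ⟨π₀, hπ₀, -⟩ := exists_mem_maximizingCouplings_integral_le hc_cont P hf₀ one_pos
  have hcost : Continuous fun p : C(Ξ, ℝ) × ProbabilityMeasure (Ξ × Ξ) =>
      ∫ q, c q.1 q.2 ∂(p.2 : Measure (Ξ × Ξ)) :=
    (ProbabilityMeasure.continuous_integral_continuousMap
      (⟨_, hc_cont⟩ : C(Ξ × Ξ, ℝ))).comp continuous_snd
  obtain ⟨⟨f, π⟩, ⟨hf, hfst, hmax⟩, hmin⟩ :=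
    (isCompact_maximizingCouplings P hFcomp).exists_isMinOn ⟨_, hπ₀⟩ hcost.continuousOn
  have hle : ∫ q, c q.1 q.2 ∂(π : Measure (Ξ × Ξ)) ≤ ρ := by
    have : Nonempty F := ⟨⟨f, hf⟩⟩
    refine le_of_forall_pos_le_add fun ε hε => ?_
    obtain ⟨g, hg⟩ := exists_lt_of_ciInf_lt (hρ.trans_lt (lt_add_of_pos_right ρ (half_pos hε)))
    obtain ⟨π', hπ', hle'⟩ :=
      exists_mem_maximizingCouplings_integral_le hc_cont P g.2 (half_pos hε)
    have := hmin hπ'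
    simp only [mem_ofPred_eq] at this
    linarith
  have hbdd : BddAbove (range f) := (isCompact_range f.continuous).bddAbove
  have hub : ∀ Q' : Measure Ξ, IsProbabilityMeasure Q' → ∫ ξ, f ξ ∂Q' ≤ ⨆ ξ, f ξ := by
    intro Q' _
    calc ∫ ξ, f ξ ∂Q' ≤ ∫ _, (⨆ ξ, f ξ) ∂Q' :=
          integral_mono ((BoundedContinuousFunction.mkOfCompact f).integrable Q')
            (integrable_const _) fun ξ => le_ciSup hbdd ξ
      _ = _ := by simp
  have hprob : IsProbabilityMeasure ((π : Measure (Ξ × Ξ)).map Prod.snd) :=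
    Measure.isProbabilityMeasure_map measurable_snd.aemeasurable
  refine ⟨f, hf, IsGreatest.csSup_eq ⟨⟨_, hprob, ?_, le_antisymm ?_ (hub _ hprob)⟩, ?_⟩⟩
  · refine le_trans (csInf_le ⟨0, ?_⟩ ⟨(π : Measure (Ξ × Ξ)), inferInstance, hfst, rfl, rfl⟩) hle
    rintro _ ⟨π', -, -, -, rfl⟩
    exact integral_nonneg fun q => hc_nonneg _ _
  · rw [integral_map measurable_snd.aemeasurable f.continuous.aestronglyMeasurable]
    exact ciSup_le hmax
  · rintro _ ⟨Q', hQ', -, rfl⟩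
    exact hub Q' hQ'
end
end

section
/- Assume (F, ‖·‖∞) is compact. Then (F, D_F) is compact if and only if the map f ↦ argmax_Ξ f is continuous from (F, ‖·‖∞) to the space K(Ξ) of nonempty compact subsets of Ξ equipped with the Hausdorff distance d_H. -/
open MeasureTheory Set Filter

noncomputable section

/-- The distance `D_F(f, g) = ‖f - g‖∞ + d_H(argmax f, argmax g)`. -/
def DF {Ξ : Type*} [MetricSpace Ξ] [CompactSpace Ξ] (f g : C(Ξ, ℝ)) : ℝ :=
  dist f g + Metric.hausdorffDist (argmaxSet f) (argmaxSet g)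

theorem dist_le_DF {Ξ : Type*} [MetricSpace Ξ] [CompactSpace Ξ] (f g : C(Ξ, ℝ)) :
    dist f g ≤ DF f g :=
  le_add_of_nonneg_right Metric.hausdorffDist_nonneg

theorem hausdorffDist_le_DF {Ξ : Type*} [MetricSpace Ξ] [CompactSpace Ξ] (f g : C(Ξ, ℝ)) :
    Metric.hausdorffDist (argmaxSet f) (argmaxSet g) ≤ DF f g :=
  le_add_of_nonneg_left dist_nonneg

/-- **Continuity of maximizers** (Proposition F.5): for `(F, ‖·‖∞)` compact, the metric
space `(F, D_F)` is (sequentially) compact iff `f ↦ argmax_Ξ f` is continuous from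
`(F, ‖·‖∞)` to the nonempty compact subsets of `Ξ` with the Hausdorff distance. -/
theorem compact_DF_iff_argmax_continuous
    {Ξ : Type*} [MetricSpace Ξ] [CompactSpace Ξ] [Nonempty Ξ]
    (F : Set C(Ξ, ℝ)) (hFcomp : IsCompact F) :
    (∀ u : ℕ → C(Ξ, ℝ), (∀ n, u n ∈ F) →
      ∃ f ∈ F, ∃ φ : ℕ → ℕ, StrictMono φ ∧
        Tendsto (fun n => DF (u (φ n)) f) atTop (nhds 0)) ↔
    (∀ f ∈ F, ∀ ε > (0 : ℝ), ∃ η > (0 : ℝ), ∀ g ∈ F, dist g f < η →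
      Metric.hausdorffDist (argmaxSet g) (argmaxSet f) < ε) := by
  constructor
  · intro h f hf ε hε
    by_contra! hbad
    have hpos (n : ℕ) : (0 : ℝ) < 1 / ((n : ℝ) + 1) := by positivity
    choose u huF hud huε using fun n : ℕ => hbad _ (hpos n)
    obtain ⟨g, -, φ, hφ, hlim⟩ := h u huF
    have hug : Tendsto (u ∘ φ) atTop (nhds g) :=
      tendsto_iff_dist_tendsto_zero.2 <| squeeze_zero (fun _ => dist_nonneg)
        (fun n => dist_le_DF (u (φ n)) g) hlim
    have huf : Tendsto u atTop (nhds f) :=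
      tendsto_iff_dist_tendsto_zero.2 <| squeeze_zero (fun _ => dist_nonneg)
        (fun n => (hud n).le) tendsto_one_div_add_atTop_nhds_zero_nat
    obtain rfl := tendsto_nhds_unique hug (huf.comp hφ.tendsto_atTop)
    obtain ⟨n, hn⟩ := (hlim.eventually_lt_const hε).exists
    exact absurd ((hausdorffDist_le_DF (u (φ n)) g).trans_lt hn) (huε (φ n)).not_gt
  · intro h u hu
    obtain ⟨f, hf, φ, hφ, hlim⟩ := hFcomp.isSeqCompact hu
    refine ⟨f, hf, φ, hφ, ?_⟩
    have hdist := tendsto_iff_dist_tendsto_zero.1 hlim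
    have hargmax : Tendsto
        (fun n => Metric.hausdorffDist (argmaxSet (u (φ n))) (argmaxSet f)) atTop (nhds 0) := by
      refine Metric.tendsto_nhds.2 fun ε hε => ?_
      obtain ⟨η, hη, hη'⟩ := h f hf ε hε
      filter_upwards [hdist.eventually_lt_const hη] with n hn
      rw [Real.dist_0_eq_abs, abs_of_nonneg Metric.hausdorffDist_nonneg]
      exact hη' _ (hu _) hn
    simpa [DF] using hdist.add hargmax
end
end
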